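/- Let D ⊆ ℝ³ be a measurable set and let p, q : D → ℝ³ be measurable with ‖p‖₄ < ∞ and ‖q‖₄ < ∞. Then the function x ↦ ⟪|p(x)|²p(x) − |q(x)|²q(x), p(x) − q(x)⟫ is integrable on D and ∫_D ⟪|p(x)|²p(x) − |q(x)|²q(x), p(x) − q(x)⟫ dx ≥ (1/2)∫_D |p(x)|²|p(x) − q(x)|² dx + (1/2)∫_D |q(x)|²|p(x) − q(x)|² dx ≥ (1/4)‖p − q‖₄⁴ ≥ 0. -/

import Mathlib

open MeasureTheory RealInnerProductSpace

section CubicMonotonicity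

variable {E : Type*} [NormedAddCommGroup E] [InnerProductSpace ℝ E]

/-- The polarisation identity behind the monotonicity of `u ↦ |u|²u`. -/
theorem inner_norm_sq_smul_sub_eq (u v : E) :
    ⟪‖u‖ ^ 2 • u - ‖v‖ ^ 2 • v, u - v⟫
      = (1 / 2 : ℝ) * (‖u‖ ^ 2 * ‖u - v‖ ^ 2) + (1 / 2 : ℝ) * (‖v‖ ^ 2 * ‖u - v‖ ^ 2)
        + (1 / 2 : ℝ) * (‖u‖ ^ 2 - ‖v‖ ^ 2) ^ 2 := by
  rw [norm_sub_sq_real]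
  simp only [inner_sub_left, inner_sub_right, real_inner_smul_left, real_inner_self_eq_norm_sq,
    real_inner_comm u v]
  ring

theorem norm_sub_pow_four_le (u v : E) :
    (1 / 4 : ℝ) * ‖u - v‖ ^ 4
      ≤ (1 / 2 : ℝ) * (‖u‖ ^ 2 * ‖u - v‖ ^ 2) + (1 / 2 : ℝ) * (‖v‖ ^ 2 * ‖u - v‖ ^ 2) := by
  have h := parallelogram_law_with_norm ℝ u v
  have h' : ‖u - v‖ ^ 2 ≤ 2 * (‖u‖ ^ 2 + ‖v‖ ^ 2) := by
    nlinarith [mul_self_nonneg ‖u + v‖]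
  nlinarith [mul_le_mul_of_nonneg_left h' (sq_nonneg ‖u - v‖)]

end CubicMonotonicity

theorem MeasureTheory.MemLp.integrable_norm_sq_mul_norm_sq {α E F : Type*} [MeasurableSpace α]
    {μ : Measure α} [NormedAddCommGroup E] [NormedAddCommGroup F] {f : α → E} {g : α → F}
    (hf : MemLp f 4 μ) (hg : MemLp g 4 μ) :
    Integrable (fun x => ‖f x‖ ^ 2 * ‖g x‖ ^ 2) μ := by
  have hf4 : Integrable (fun x => ‖f x‖ ^ 4) μ := hf.integrable_norm_pow (p := 4) (by norm_num)
  have hg4 : Integrable (fun x => ‖g x‖ ^ 4) μ := hg.integrable_norm_pow (p := 4) (by norm_num)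
  refine (hf4.add hg4).mono' ((hf.1.norm.pow 2).mul (hg.1.norm.pow 2)) (.of_forall fun x => ?_)
  rw [Real.norm_of_nonneg (by positivity), Pi.add_apply]
  nlinarith [sq_nonneg (‖f x‖ ^ 2 - ‖g x‖ ^ 2), sq_nonneg (‖f x‖ ^ 2 + ‖g x‖ ^ 2)]

/-- For `p, q ∈ L⁴(D; ℝ³)`, the function
`x ↦ ⟪|p(x)|²p(x) − |q(x)|²q(x), p(x) − q(x)⟫` is integrable on `D` and
`∫_D ⟪|p|²p − |q|²q, p − q⟫ ≥ (1/2)∫_D |p|²|p − q|² + (1/2)∫_D |q|²|p − q|²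
  ≥ (1/4)‖p − q‖₄⁴ ≥ 0`. -/
theorem cubic_nonlinearity_integral_monotonicity
    (D : Set (EuclideanSpace ℝ (Fin 3))) (hD : MeasurableSet D)
    (p q : EuclideanSpace ℝ (Fin 3) → EuclideanSpace ℝ (Fin 3))
    (hpm : Measurable p) (hqm : Measurable q)
    (hp : MemLp p 4 (volume.restrict D)) (hq : MemLp q 4 (volume.restrict D)) :
    IntegrableOn (fun x => ⟪‖p x‖ ^ 2 • p x - ‖q x‖ ^ 2 • q x, p x - q x⟫) D
      ∧ (∫ x in D, ⟪‖p x‖ ^ 2 • p x - ‖q x‖ ^ 2 • q x, p x - q x⟫)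
          ≥ (1 / 2 : ℝ) * (∫ x in D, ‖p x‖ ^ 2 * ‖p x - q x‖ ^ 2)
            + (1 / 2 : ℝ) * (∫ x in D, ‖q x‖ ^ 2 * ‖p x - q x‖ ^ 2)
      ∧ (1 / 2 : ℝ) * (∫ x in D, ‖p x‖ ^ 2 * ‖p x - q x‖ ^ 2)
            + (1 / 2 : ℝ) * (∫ x in D, ‖q x‖ ^ 2 * ‖p x - q x‖ ^ 2)
          ≥ (1 / 4 : ℝ) * (∫ x in D, ‖p x - q x‖ ^ 4)
      ∧ (1 / 4 : ℝ) * (∫ x in D, ‖p x - q x‖ ^ 4) ≥ 0 := by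
  have hpq : MemLp (fun x => p x - q x) 4 (volume.restrict D) := hp.sub hq
  have h₁ := (hp.integrable_norm_sq_mul_norm_sq hpq).const_mul (1 / 2 : ℝ)
  have h₂ := (hq.integrable_norm_sq_mul_norm_sq hpq).const_mul (1 / 2 : ℝ)
  have h₄ : Integrable (fun x => ‖p x - q x‖ ^ 4) (volume.restrict D) :=
    hpq.integrable_norm_pow (p := 4) (by norm_num)
  have hsq : Integrable (fun x => (‖p x‖ ^ 2 - ‖q x‖ ^ 2) ^ 2) (volume.restrict D) := by
    refine (((hp.integrable_norm_sq_mul_norm_sq hp).sub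
      ((hp.integrable_norm_sq_mul_norm_sq hq).const_mul 2)).add
      (hq.integrable_norm_sq_mul_norm_sq hq)).congr (.of_forall fun x => ?_)
    simp only [Pi.add_apply, Pi.sub_apply]
    ring
  have hint : IntegrableOn
      (fun x => ⟪‖p x‖ ^ 2 • p x - ‖q x‖ ^ 2 • q x, p x - q x⟫) D := by
    simp only [inner_norm_sq_smul_sub_eq]
    exact (h₁.add h₂).add (hsq.const_mul _)
  refine ⟨hint, ?_, ?_, by positivity⟩
  · rw [ge_iff_le, ← integral_const_mul, ← integral_const_mul, ← integral_add h₁ h₂]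
    refine integral_mono (h₁.add h₂) hint fun x => ?_
    simp only [inner_norm_sq_smul_sub_eq]
    exact le_add_of_nonneg_right (by positivity)
  · rw [ge_iff_le, ← integral_const_mul, ← integral_const_mul, ← integral_const_mul,
      ← integral_add h₁ h₂]
    exact integral_mono (h₄.const_mul _) (h₁.add h₂) fun x => norm_sub_pow_four_le _ _
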